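/- Let R be a commutative ring, f ∈ R a non-zero-divisor, R̂ the f-adic completion of R. Beauville–Laszlo gluing for free modules of rank 1: the groupoid of triples (M_e, M_+, ι) where M_e is a free R[1/f]-module of rank 1, M_+ a free R̂-module of rank 1, and ι an isomorphism M_e ⊗_{R[1/f]} R̂[1/f] ≅ M_+ ⊗_{R̂} R̂[1/f], has its isomorphism classes in bijection with isomorphism classes of R-modules M that are f-regular and such that M[1/f] is free of rank 1 over R[1/f] and M ⊗_R R̂ is free of rank 1 over R̂ (via M ↦ (M[1/f], M ⊗ R̂, canonical ι)), provided f is a non-zero-divisor on R̂. -/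

import Mathlib

noncomputable section
set_option maxHeartbeats 1000000
set_option synthInstance.maxHeartbeats 400000

abbrev Cpl (R : Type) [CommRing R] (f : R) : Type :=
  AdicCompletion (Ideal.span {f}) R

abbrev fCpl (R : Type) [CommRing R] (f : R) : Cpl R f :=
  algebraMap R (Cpl R f) f

abbrev locMap (R : Type) [CommRing R] (f : R) :
    Localization.Away f →+* Localization.Away (fCpl R f) :=
  Localization.awayMap (algebraMap R (Cpl R f)) f

abbrev cplMap (R : Type) [CommRing R] (f : R) :
    Cpl R f →+* Localization.Away (fCpl R f) :=
  algebraMap (Cpl R f) (Localization.Away (fCpl R f))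

lemma locMap_algebraMap (R : Type) [CommRing R] (f : R) (r : R) :
    locMap R f (algebraMap R (Localization.Away f) r)
      = cplMap R f (algebraMap R (Cpl R f) r) :=
  IsLocalization.map_eq _ r

def gluedModule (R : Type) [CommRing R] (f : R)
    (u : (Localization.Away (fCpl R f))ˣ) :
    Submodule R (Localization.Away f × Cpl R f) where
  carrier := {p | locMap R f p.1 = (u : Localization.Away (fCpl R f)) * cplMap R f p.2}
  add_mem' := by
    intro a b ha hb
    simp only [Set.mem_setOf_eq, Prod.fst_add, Prod.snd_add] at ha hb ⊢
    rw [(locMap R f).map_add, (cplMap R f).map_add, ha, hb, mul_add]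
  zero_mem' := by
    simp only [Set.mem_setOf_eq, Prod.fst_zero, Prod.snd_zero,
      (locMap R f).map_zero, (cplMap R f).map_zero, mul_zero]
  smul_mem' := by
    intro r p hp
    simp only [Set.mem_setOf_eq, Prod.smul_fst, Prod.smul_snd] at hp ⊢
    rw [Algebra.smul_def, Algebra.smul_def, (locMap R f).map_mul,
      (cplMap R f).map_mul, hp, locMap_algebraMap]
    ring


open TensorProduct

/-- Abstract setting: `R → S = R[1/f]`, `T` the completion, `W = T[1/f]`, `j : S → W`. -/
structure BLSetup (R S T W : Type) [CommRing R] [CommRing S] [CommRing T] [CommRing W]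
    [Algebra R S] [Algebra R T] [Algebra R W] [Algebra T W] [IsScalarTower R T W]
    (f : R) (j : S →ₐ[R] W) : Prop where
  uS : IsUnit (algebraMap R S f)
  iS : Function.Injective (algebraMap R S)
  sS : ∀ s : S, ∃ (n : ℕ) (r : R), algebraMap R S (f ^ n) * s = algebraMap R S r
  sW : ∀ w : W, ∃ (n : ℕ) (t : T), algebraMap R W (f ^ n) * w = algebraMap T W t
  iW : Function.Injective (algebraMap T W)
  approx : ∀ (n : ℕ) (y : T), ∃ (r : R) (z : T), y = algebraMap R T r + algebraMap R T (f ^ n) * z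
  dvd : ∀ (n : ℕ) (r : R) (y : T), algebraMap R T r = algebraMap R T (f ^ n) * y → f ^ n ∣ r
  unit : ∀ z : T, IsUnit (1 - algebraMap R T f * z)

/-- `G` is the fibre product of `S` and `T` over `W`, glued along `u`. -/
structure BLGlue {R S T W : Type} [CommRing R] [CommRing S] [CommRing T] [CommRing W]
    [Algebra R S] [Algebra R T] [Algebra R W] [Algebra T W] [IsScalarTower R T W]
    (j : S →ₐ[R] W) (u : Wˣ) {G : Type} [AddCommGroup G] [Module R G]
    (α : G →ₗ[R] S) (β : G →ₗ[R] T) : Prop where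
  comm : ∀ g, j (α g) = u * algebraMap T W (β g)
  surj : ∀ x y, j x = u * algebraMap T W y → ∃ g, α g = x ∧ β g = y
  inj : ∀ g, α g = 0 → β g = 0 → g = 0

section abstractBL

variable {R S T W : Type} [CommRing R] [CommRing S] [CommRing T] [CommRing W]
    [Algebra R S] [Algebra R T] [Algebra R W] [Algebra T W] [IsScalarTower R T W]
    {f : R} {j : S →ₐ[R] W}

namespace BLSetup

theorem uSn (H : BLSetup R S T W f j) (n : ℕ) : IsUnit (algebraMap R S (f ^ n)) := by
  rw [map_pow]; exact H.uS.pow n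

theorem uWn (H : BLSetup R S T W f j) (n : ℕ) : IsUnit (algebraMap R W (f ^ n)) := by
  have := (H.uSn n).map j
  rwa [AlgHom.commutes] at this

theorem pullback (H : BLSetup R S T W f j) (s : S) (t : T) (h : j s = algebraMap T W t) :
    ∃ r : R, s = algebraMap R S r ∧ t = algebraMap R T r := by
  obtain ⟨n, r0, hr⟩ := H.sS s
  have h1 : algebraMap R T r0 = algebraMap R T (f ^ n) * t := by
    apply H.iW
    rw [map_mul, ← h, ← IsScalarTower.algebraMap_apply, ← IsScalarTower.algebraMap_apply,
      ← j.commutes r0, ← j.commutes (f ^ n), ← hr, map_mul]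
  obtain ⟨r, rfl⟩ := H.dvd n r0 t h1
  have h2 : s = algebraMap R S r := by
    rw [map_mul] at hr
    exact (H.uSn n).mul_left_cancel hr
  refine ⟨r, h2, ?_⟩
  apply H.iW
  rw [← h, h2, j.commutes, ← IsScalarTower.algebraMap_apply]

theorem key (H : BLSetup R S T W f j) {M : Type} [AddCommGroup M] [Module R M]
    (α : M →ₗ[R] S) (hα : Function.Injective α)
    (hs : ∀ s : S, ∃ (n : ℕ) (m : M), (f ^ n) • s = α m)
    (t : T ⊗[R] M) (s : S)
    (ht : LinearMap.liftBaseChange T (j.toLinearMap ∘ₗ α) t = j s) :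
    ∃ m : M, t = 1 ⊗ₜ m ∧ α m = s := by
  obtain ⟨n, h, hh⟩ := hs 1
  have hh' : α h = algebraMap R S (f ^ n) := by rw [← hh, Algebra.smul_def, mul_one]
  have dec : ∃ (m : M) (b : T), t = 1 ⊗ₜ[R] m + b ⊗ₜ[R] h := by
    clear ht
    induction t using TensorProduct.induction_on with
    | zero => exact ⟨0, 0, by simp⟩
    | add x y hx hy =>
      obtain ⟨m, b, rfl⟩ := hx
      obtain ⟨m', b', rfl⟩ := hy
      exact ⟨m + m', b + b', by rw [tmul_add, add_tmul]; abel⟩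
    | tmul a m =>
      obtain ⟨k, r, hr⟩ := H.sS (α m)
      have h1 : (f ^ (n + k)) • m = r • h := by
        apply hα
        rw [map_smul, map_smul, hh', pow_add, mul_smul, Algebra.smul_def (f ^ k), hr,
          Algebra.smul_def, Algebra.smul_def, mul_comm]
      obtain ⟨s', z, rfl⟩ := H.approx (n + k) a
      refine ⟨s' • m, r • z, ?_⟩
      rw [add_tmul, ← Algebra.smul_def, smul_tmul, h1, ← smul_tmul]
      congr 1
      rw [Algebra.algebraMap_eq_smul_one, smul_tmul]
  obtain ⟨m, b, rfl⟩ := dec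
  obtain ⟨e, he⟩ := (H.uSn n).exists_right_inv
  have h2 : j ((s - α m) * e) = algebraMap T W b := by
    rw [map_add, LinearMap.liftBaseChange_tmul, LinearMap.liftBaseChange_tmul, one_smul] at ht
    simp only [LinearMap.comp_apply, AlgHom.toLinearMap_apply, hh'] at ht
    rw [map_mul, map_sub, ← ht, add_sub_cancel_left, Algebra.smul_def, mul_assoc, ← map_mul, he,
      map_one, mul_one]
  obtain ⟨r, hr1, hr2⟩ := H.pullback _ _ h2
  refine ⟨m + r • h, ?_, ?_⟩
  · rw [hr2, tmul_add, Algebra.algebraMap_eq_smul_one, smul_tmul]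
  · rw [map_add, map_smul, hh', Algebra.smul_def, ← hr1, mul_assoc, mul_comm e, he]
    ring

end BLSetup

namespace BLGlue

variable {u : Wˣ} {G : Type} [AddCommGroup G] [Module R G] {α : G →ₗ[R] S} {β : G →ₗ[R] T}

theorem α_inj (H : BLSetup R S T W f j) (h : BLGlue j u α β) : Function.Injective α := by
  rw [injective_iff_map_eq_zero]
  intro g hg
  refine h.inj g hg ?_
  have := h.comm g
  rw [hg, map_zero] at this
  apply H.iW
  rw [map_zero]
  exact u.isUnit.mul_left_cancel (by rw [← this, mul_zero])

theorem α_surj (H : BLSetup R S T W f j) (h : BLGlue j u α β) (s : S) :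
    ∃ (n : ℕ) (m : G), (f ^ n) • s = α m := by
  obtain ⟨n, t, ht⟩ := H.sW (↑u⁻¹ * j s)
  obtain ⟨g, hg, -⟩ := h.surj ((f ^ n) • s) t (by
    rw [← ht, mul_left_comm, Units.mul_inv_cancel_left, Algebra.smul_def, map_mul, j.commutes])
  exact ⟨n, g, hg.symm⟩

theorem exists_unit (H : BLSetup R S T W f j) (h : BLGlue j u α β) : ∃ g, IsUnit (β g) := by
  obtain ⟨k, v, hv⟩ := H.sW (↑u⁻¹ : W)
  obtain ⟨m, w, hw⟩ := H.sW (u : W)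
  obtain ⟨r, z, rfl⟩ := H.approx (m + k + 1) w
  obtain ⟨e, he⟩ := (H.uSn m).exists_right_inv
  have hu : algebraMap R W (f ^ k) = u * algebraMap T W v := by
    rw [← hv, mul_left_comm, Units.mul_inv, mul_one]
  obtain ⟨g, -, hg⟩ := h.surj (algebraMap R S r * e) (1 - algebraMap R T f * (v * z)) (by
    apply (H.uWn m).mul_left_cancel
    have e1 : algebraMap R W (f ^ m) * j e = 1 := by
      rw [← j.commutes, ← map_mul, he, map_one]
    rw [map_mul, j.commutes, mul_left_comm, e1, mul_one]
    simp only [map_sub, map_add, map_mul, map_one, ← IsScalarTower.algebraMap_apply,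
      pow_add, pow_one] at hw hu ⊢
    linear_combination (-1) * hw - algebraMap R W (f ^ m) * algebraMap R W f *
      algebraMap T W z * hu)
  exact ⟨g, hg ▸ H.unit _⟩

theorem comm_tensor (h : BLGlue j u α β) (t : T ⊗[R] G) :
    LinearMap.liftBaseChange T (j.toLinearMap ∘ₗ α) t
      = u * algebraMap T W (LinearMap.liftBaseChange T β t) := by
  induction t using TensorProduct.induction_on with
  | zero => simp
  | add x y hx hy => rw [map_add, map_add, map_add, mul_add, hx, hy]
  | tmul a m =>
    rw [LinearMap.liftBaseChange_tmul, LinearMap.liftBaseChange_tmul, LinearMap.comp_apply,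
      AlgHom.toLinearMap_apply, h.comm, smul_eq_mul, map_mul, Algebra.smul_def, mul_left_comm]

theorem tensor_bij (H : BLSetup R S T W f j) (h : BLGlue j u α β) :
    Function.Bijective (LinearMap.liftBaseChange T β) := by
  constructor
  · rw [injective_iff_map_eq_zero]
    intro t ht
    obtain ⟨m, rfl, hm⟩ := H.key α (h.α_inj H) (h.α_surj H) t 0 (by
      rw [h.comm_tensor, ht]; simp)
    rw [h.α_inj H (hm.trans (map_zero α).symm), tmul_zero]
  · intro y
    obtain ⟨g, hg⟩ := h.exists_unit H
    obtain ⟨e, he⟩ := hg.exists_left_inv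
    exact ⟨(y * e) ⊗ₜ g, by
      rw [LinearMap.liftBaseChange_tmul, smul_eq_mul, mul_assoc, he, mul_one]⟩

theorem isLocalizedModule (H : BLSetup R S T W f j) (h : BLGlue j u α β) :
    IsLocalizedModule (Submonoid.powers f) α where
  map_units := by
    rintro ⟨_, n, rfl⟩
    rw [Module.End.isUnit_iff]
    obtain ⟨e, he⟩ := (H.uSn n).exists_right_inv
    constructor
    · intro x y hxy
      simp only [Module.algebraMap_end_apply, Algebra.smul_def] at hxy
      exact (H.uSn n).mul_left_cancel hxy
    · intro y
      exact ⟨e * y, by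
        simp only [Module.algebraMap_end_apply, Algebra.smul_def]
        rw [← mul_assoc, he, one_mul]⟩
  surj := by
    intro y
    obtain ⟨n, m, hm⟩ := h.α_surj H y
    exact ⟨(m, ⟨f ^ n, n, rfl⟩), hm⟩
  exists_of_eq := by
    intro x y hxy
    exact ⟨1, by rw [h.α_inj H hxy]⟩

theorem regular (H : BLSetup R S T W f j) (h : BLGlue j u α β) (g : G) (hg : f • g = 0) :
    g = 0 := by
  apply h.α_inj H
  rw [map_zero]
  apply H.uS.mul_left_cancel
  rw [← Algebra.smul_def, ← map_smul, hg, map_zero, mul_zero]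

variable {u' : Wˣ} {G' : Type} [AddCommGroup G'] [Module R G'] {α' : G' →ₗ[R] S} {β' : G' →ₗ[R] T}

/-- A linear map between glued modules is multiplication by a scalar on `S`. -/
theorem exists_scalar (H : BLSetup R S T W f j) (h : BLGlue j u α β) (φ : G →ₗ[R] G')
    (α' : G' →ₗ[R] S) : ∃ a : S, ∀ g, α' (φ g) = a * α g := by
  obtain ⟨n, k, hk⟩ := h.α_surj H 1
  rw [Algebra.smul_def, mul_one] at hk
  obtain ⟨e, he⟩ := (H.uSn n).exists_right_inv
  refine ⟨α' (φ k) * e, fun g => ?_⟩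
  obtain ⟨m, r, hr⟩ := H.sS (α g)
  have h1 : (f ^ (n + m)) • g = r • k := by
    apply h.α_inj H
    rw [map_smul, map_smul, ← hk, pow_add, mul_smul, Algebra.smul_def (f ^ m), hr,
      Algebra.smul_def, Algebra.smul_def, mul_comm]
  have h2 := congrArg (fun x => α' (φ x)) h1
  simp only [map_smul, Algebra.smul_def] at h2
  apply (H.uSn (n + m)).mul_left_cancel
  rw [h2, pow_add, map_mul]
  linear_combination (-(α' (φ k) * e * algebraMap R S (f ^ n))) * hr
    - algebraMap R S r * α' (φ k) * he

theorem iso_imp (H : BLSetup R S T W f j) (h : BLGlue j u α β) (h' : BLGlue j u' α' β')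
    (φ : G ≃ₗ[R] G') : ∃ (a : Sˣ) (b : Tˣ),
      u' = Units.map j.toRingHom.toMonoidHom a * u *
        Units.map (algebraMap T W).toMonoidHom b := by
  obtain ⟨a, ha⟩ := h.exists_scalar H φ.toLinearMap α'
  obtain ⟨a', ha'⟩ := h'.exists_scalar H φ.symm.toLinearMap α
  have haa : a * a' = 1 := by
    obtain ⟨n, k, hk⟩ := h.α_surj H 1
    rw [Algebra.smul_def, mul_one] at hk
    have h1 := ha' (φ k)
    have h2 := ha k
    simp only [LinearEquiv.coe_coe, LinearEquiv.symm_apply_apply] at h1 h2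
    apply (H.uSn n).mul_left_cancel
    rw [hk]
    linear_combination (-1) * h1 - a' * h2
  have hja : j a * j a' = 1 := by rw [← map_mul, haa, map_one]
  obtain ⟨g, hg⟩ := h.exists_unit H
  obtain ⟨g', hg'⟩ := h'.exists_unit H
  obtain ⟨e, he⟩ := hg.exists_right_inv
  obtain ⟨e', he'⟩ := hg'.exists_right_inv
  have iu : (u : W) * ↑u⁻¹ = 1 := u.mul_inv
  have iu' : (u' : W) * ↑u'⁻¹ = 1 := u'.mul_inv
  have hE : algebraMap T W (β g) * algebraMap T W e = 1 := by rw [← map_mul, he, map_one]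
  have hE' : algebraMap T W (β' g') * algebraMap T W e' = 1 := by rw [← map_mul, he', map_one]
  have hc : algebraMap T W (β' (φ g) * e) = ↑u'⁻¹ * j a * u := by
    have h1 := congrArg j (ha g)
    simp only [LinearEquiv.coe_coe] at h1
    rw [h'.comm, map_mul, h.comm] at h1
    rw [map_mul]
    linear_combination (algebraMap T W e * ↑u'⁻¹) * h1
      - algebraMap T W e * algebraMap T W (β' (φ g)) * iu' + ↑u'⁻¹ * j a * u * hE
  have hc' : algebraMap T W (β (φ.symm g') * e') = ↑u⁻¹ * j a' * u' := by
    have h1 := congrArg j (ha' g')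
    simp only [LinearEquiv.coe_coe] at h1
    rw [h.comm, map_mul, h'.comm] at h1
    rw [map_mul]
    linear_combination (algebraMap T W e' * ↑u⁻¹) * h1
      - algebraMap T W e' * algebraMap T W (β (φ.symm g')) * iu + ↑u⁻¹ * j a' * u' * hE'
  have hcc : (β' (φ g) * e) * (β (φ.symm g') * e') = 1 := by
    apply H.iW
    rw [map_mul, hc, hc', map_one]
    linear_combination (u : W) * ↑u⁻¹ * u' * ↑u'⁻¹ * hja + u' * ↑u'⁻¹ * iu + iu'
  refine ⟨⟨a, a', haa, by rw [mul_comm, haa]⟩,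
    ⟨_, _, (mul_comm _ _).trans hcc, hcc⟩, ?_⟩
  ext
  change (u' : W) = j a * u * algebraMap T W (β (φ.symm g') * e')
  rw [hc']
  linear_combination (-(u * ↑u⁻¹ * u' : W)) * hja - u' * iu

end BLGlue

theorem BLSetup.exists_glue (H : BLSetup R S T W f j) {M : Type} [AddCommGroup M] [Module R M]
    (α : M →ₗ[R] S) (hα : Function.Injective α)
    (hs : ∀ s : S, ∃ (n : ℕ) (m : M), (f ^ n) • s = α m)
    (β : T ⊗[R] M ≃ₗ[T] T) :
    ∃ u : Wˣ, BLGlue j u α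
      ((β.toLinearMap.restrictScalars R) ∘ₗ (TensorProduct.mk R T M 1)) := by
  set A := LinearMap.liftBaseChange T (j.toLinearMap ∘ₗ α) with hA
  have hw : ∀ t, A t = A (β.symm 1) * algebraMap T W (β t) := by
    intro t
    have : t = β t • β.symm 1 := by
      rw [← map_smul, smul_eq_mul, mul_one, LinearEquiv.symm_apply_apply]
    conv_lhs => rw [this]
    rw [map_smul, Algebra.smul_def, mul_comm]
  have hA1 : ∀ m, A (1 ⊗ₜ m) = j (α m) := by
    intro m
    rw [hA, LinearMap.liftBaseChange_tmul, one_smul]; rfl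
  obtain ⟨n, k, hk⟩ := hs 1
  rw [Algebra.smul_def, mul_one] at hk
  have hu : IsUnit (A (β.symm 1)) := by
    have h1 := hw (1 ⊗ₜ k)
    rw [hA1, ← hk, j.commutes] at h1
    exact isUnit_of_mul_isUnit_left (h1 ▸ H.uWn n)
  obtain ⟨u, hu⟩ := hu
  refine ⟨u, ?_, ?_, ?_⟩
  · intro m
    rw [← hA1, hw, hu]; rfl
  · intro x y hxy
    obtain ⟨m, hm1, hm2⟩ := H.key α hα hs (β.symm y) x (by
      rw [← hA, hw, LinearEquiv.apply_symm_apply, hxy, hu])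
    refine ⟨m, hm2, ?_⟩
    change β (1 ⊗ₜ m) = y
    rw [← hm1, LinearEquiv.apply_symm_apply]
  · intro g hg _
    exact hα (hg.trans (map_zero α).symm)

/-- Two glueings, related by scalars, are isomorphic. -/
theorem BLGlue.iso_of_rel {u u' : Wˣ} {G G' : Type} [AddCommGroup G] [Module R G]
    [AddCommGroup G'] [Module R G'] {α : G →ₗ[R] S} {β : G →ₗ[R] T}
    {α' : G' →ₗ[R] S} {β' : G' →ₗ[R] T}
    (h : BLGlue j u α β) (h' : BLGlue j u' α' β') (a : Sˣ) (b : Tˣ)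
    (hab : u' = Units.map j.toRingHom.toMonoidHom a * u *
        Units.map (algebraMap T W).toMonoidHom b) : Nonempty (G ≃ₗ[R] G') := by
  have hab' : (u' : W) = j a * u * algebraMap T W b := by rw [hab]; rfl
  have ja : j a * j ↑a⁻¹ = 1 := by rw [← map_mul, a.mul_inv, map_one]
  have jb : algebraMap T W b * algebraMap T W ↑b⁻¹ = 1 := by rw [← map_mul, b.mul_inv, map_one]
  have key : ∀ g, ∃ g', α' g' = a * α g ∧ β' g' = ↑b⁻¹ * β g := by
    intro g
    apply h'.surj
    rw [map_mul, map_mul, h.comm, hab']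
    linear_combination (-(j a * u * algebraMap T W (β g))) * jb
  choose φ hφ1 hφ2 using key
  have ext' : ∀ x y, α' x = α' y → β' x = β' y → x = y := by
    intro x y h1 h2
    rw [← sub_eq_zero]
    exact h'.inj _ (by rw [map_sub, h1, sub_self]) (by rw [map_sub, h2, sub_self])
  let Φ : G →ₗ[R] G' :=
    { toFun := φ
      map_add' := fun x y => ext' _ _ (by simp only [map_add, hφ1, mul_add])
        (by simp only [map_add, hφ2, mul_add])
      map_smul' := fun r x => ext' _ _ (by simp [hφ1]) (by simp [hφ2]) }
  refine ⟨LinearEquiv.ofBijective Φ ⟨?_, ?_⟩⟩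
  · rw [injective_iff_map_eq_zero]
    intro g hg
    have hg' : φ g = 0 := hg
    have h1 := hφ1 g
    have h2 := hφ2 g
    rw [hg', map_zero] at h1 h2
    exact h.inj g (a.isUnit.mul_left_cancel (by rw [← h1, mul_zero]))
      (b⁻¹.isUnit.mul_left_cancel (by rw [← h2, mul_zero]))
  · intro g'
    obtain ⟨g, h1, h2⟩ := h.surj (↑a⁻¹ * α' g') (b * β' g') (by
      rw [map_mul, map_mul, h'.comm, hab']
      linear_combination (u * algebraMap T W b * algebraMap T W (β' g')) * ja)
    refine ⟨g, ext' _ _ ?_ ?_⟩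
    · change α' (φ g) = _
      rw [hφ1, h1, Units.mul_inv_cancel_left]
    · change β' (φ g) = _
      rw [hφ2, h2, Units.inv_mul_cancel_left]

end abstractBL

/-- The ring map `R[1/f] → R̂[1/f]` as an `R`-algebra map. -/
def jMap (R : Type) [CommRing R] (f : R) :
    Localization.Away f →ₐ[R] Localization.Away (fCpl R f) :=
  { locMap R f with
    commutes' := fun r => (locMap_algebraMap R f r).trans
      (IsScalarTower.algebraMap_apply R (Cpl R f) (Localization.Away (fCpl R f)) r).symm }

theorem cpl_approx (R : Type) [CommRing R] (f : R) (n : ℕ) (y : Cpl R f) :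
    ∃ (r : R) (z : Cpl R f), y = algebraMap R (Cpl R f) r + algebraMap R (Cpl R f) (f ^ n) * z := by
  obtain ⟨r, hr⟩ := Submodule.Quotient.mk_surjective _ (AdicCompletion.eval (Ideal.span {f}) R n y)
  have h1 : y - algebraMap R (Cpl R f) r ∈ (AdicCompletion.eval (Ideal.span {f}) R n).ker := by
    rw [LinearMap.mem_ker, map_sub, ← hr, sub_eq_zero]
    rfl
  rw [← AdicCompletion.pow_smul_top_eq_ker_eval ⟨{f}, by simp⟩, Ideal.span_singleton_pow,
    Submodule.ideal_span_singleton_smul, Submodule.mem_smul_pointwise_iff_exists] at h1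
  obtain ⟨z, -, hz⟩ := h1
  exact ⟨r, z, by rw [← Algebra.smul_def, hz]; ring⟩

theorem cpl_dvd (R : Type) [CommRing R] (f : R) (n : ℕ) (r : R) (y : Cpl R f)
    (h : algebraMap R (Cpl R f) r = algebraMap R (Cpl R f) (f ^ n) * y) : f ^ n ∣ r := by
  rw [← Algebra.smul_def] at h
  have h1 : algebraMap R (Cpl R f) r ∈ (AdicCompletion.eval (Ideal.span {f}) R n).ker := by
    rw [← AdicCompletion.pow_smul_top_eq_ker_eval ⟨{f}, by simp⟩, Ideal.span_singleton_pow, h]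
    exact Submodule.smul_mem_smul (Ideal.mem_span_singleton_self _) trivial
  have h2 : (Submodule.Quotient.mk r : R ⧸ ((Ideal.span {f}) ^ n • ⊤ : Submodule R R)) = 0 := h1
  rw [Submodule.Quotient.mk_eq_zero, Ideal.span_singleton_pow] at h2
  simpa [Ideal.mem_span_singleton] using h2

theorem cpl_unit (R : Type) [CommRing R] (f : R) (z : Cpl R f) :
    IsUnit (1 - algebraMap R (Cpl R f) f * z) := by
  have : IsAdicComplete (Ideal.span {f}) (Cpl R f) :=
    AdicCompletion.isAdicComplete ⟨{f}, by simp⟩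
  have : IsAdicComplete ((Ideal.span {f}).map (algebraMap R (Cpl R f))) (Cpl R f) :=
    (IsAdicComplete.map_algebraMap_iff _ _).mpr this
  have h := IsAdicComplete.le_jacobson_bot ((Ideal.span {f}).map (algebraMap R (Cpl R f)))
  have h1 := h (Ideal.mem_map_of_mem _ (Ideal.mem_span_singleton_self f))
  rw [Ideal.mem_jacobson_bot] at h1
  have := h1 (-z)
  convert this using 1
  ring

theorem blSetup (R : Type) [CommRing R] (f : R)
    (hf : ∀ r : R, f * r = 0 → r = 0)
    (hfc : ∀ x : Cpl R f, fCpl R f * x = 0 → x = 0) :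
    BLSetup R (Localization.Away f) (Cpl R f) (Localization.Away (fCpl R f)) f (jMap R f) where
  uS := IsLocalization.Away.algebraMap_isUnit f
  iS := by
    apply IsLocalization.injective (M := Submonoid.powers f)
    rw [Submonoid.powers_le, mem_nonZeroDivisors_iff_left]
    exact hf
  sS := by
    intro s
    obtain ⟨⟨r, ⟨_, n, rfl⟩⟩, h⟩ := IsLocalization.surj (Submonoid.powers f) s
    exact ⟨n, r, by rw [mul_comm]; exact h⟩
  sW := by
    intro s
    obtain ⟨⟨r, ⟨_, n, rfl⟩⟩, h⟩ := IsLocalization.surj (Submonoid.powers (fCpl R f)) s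
    refine ⟨n, r, ?_⟩
    rw [mul_comm, IsScalarTower.algebraMap_apply R (Cpl R f), map_pow]
    exact h
  iW := by
    apply IsLocalization.injective (M := Submonoid.powers (fCpl R f))
    rw [Submonoid.powers_le, mem_nonZeroDivisors_iff_left]
    exact hfc
  approx := cpl_approx R f
  dvd := cpl_dvd R f
  unit := cpl_unit R f

theorem blGlue (R : Type) [CommRing R] (f : R) (u : (Localization.Away (fCpl R f))ˣ) :
    BLGlue (jMap R f) u
      (LinearMap.fst R (Localization.Away f) (Cpl R f) ∘ₗ (gluedModule R f u).subtype)
      (LinearMap.snd R (Localization.Away f) (Cpl R f) ∘ₗ (gluedModule R f u).subtype) where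
  comm := fun g => g.2
  surj := fun x y h => ⟨⟨(x, y), h⟩, rfl, rfl⟩
  inj := fun g h1 h2 => Subtype.ext (Prod.ext h1 h2)

theorem beauville_laszlo_rank_one
    (R : Type) [CommRing R] (f : R)
    (hf : ∀ r : R, f * r = 0 → r = 0)
    (hfc : ∀ x : Cpl R f, fCpl R f * x = 0 → x = 0) :
    -- (i) every glued triple yields an `R`-module with the stated properties
    (∀ u : (Localization.Away (fCpl R f))ˣ,
      (∀ m : gluedModule R f u, f • m = 0 → m = 0) ∧
      Nonempty (LocalizedModule (Submonoid.powers f) (gluedModule R f u)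
        ≃ₗ[Localization (Submonoid.powers f)] Localization (Submonoid.powers f)) ∧
      Nonempty (TensorProduct R (Cpl R f) (gluedModule R f u) ≃ₗ[Cpl R f] Cpl R f)) ∧
    -- (ii) two glued triples give isomorphic modules iff the gluing data are
    -- isomorphic, i.e. the units lie in the same double coset
    (∀ u u' : (Localization.Away (fCpl R f))ˣ,
      Nonempty (gluedModule R f u ≃ₗ[R] gluedModule R f u') ↔
        ∃ (a : (Localization.Away f)ˣ) (b : (Cpl R f)ˣ),
          u' = Units.map (locMap R f).toMonoidHom a * u
            * Units.map (cplMap R f).toMonoidHom b) ∧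
    -- (iii) every module with the stated properties arises from a glued triple
    (∀ (M : Type) [AddCommGroup M] [Module R M],
      (∀ m : M, f • m = 0 → m = 0) →
      Nonempty (LocalizedModule (Submonoid.powers f) M
        ≃ₗ[Localization (Submonoid.powers f)] Localization (Submonoid.powers f)) →
      Nonempty (TensorProduct R (Cpl R f) M ≃ₗ[Cpl R f] Cpl R f) →
      ∃ u : (Localization.Away (fCpl R f))ˣ,
        Nonempty (M ≃ₗ[R] gluedModule R f u)) := by
  have H := blSetup R f hf hfc
  refine ⟨fun u => ⟨(blGlue R f u).regular H, ?_, ?_⟩, fun u u' => ⟨?_, ?_⟩, ?_⟩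
  · have := (blGlue R f u).isLocalizedModule H
    exact ⟨(IsLocalizedModule.iso (Submonoid.powers f) (LinearMap.fst R (Localization.Away f)
      (Cpl R f) ∘ₗ (gluedModule R f u).subtype)).extendScalarsOfIsLocalization
        (Submonoid.powers f) (Localization (Submonoid.powers f))⟩
  · exact ⟨LinearEquiv.ofBijective _ ((blGlue R f u).tensor_bij H)⟩
  · rintro ⟨φ⟩
    exact (blGlue R f u).iso_imp H (blGlue R f u') φ
  · rintro ⟨a, b, hab⟩
    exact (blGlue R f u).iso_of_rel (blGlue R f u') a b hab
  · rintro M _ _ hM ⟨α⟩ ⟨β⟩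
    let α0 : M →ₗ[R] Localization.Away f := (α.toLinearMap.restrictScalars R) ∘ₗ
      LocalizedModule.mkLinearMap (Submonoid.powers f) M
    have hα : Function.Injective α0 := by
      intro x y hxy
      have h1 := α.injective hxy
      obtain ⟨⟨_, n, rfl⟩, hc⟩ :=
        IsLocalizedModule.exists_of_eq (S := Submonoid.powers f) h1
      have hn : ∀ (n : ℕ) (m : M), f ^ n • m = 0 → m = 0 := by
        intro n
        induction n with
        | zero => intro m hm; simpa using hm
        | succ n ih => intro m hm; rw [pow_succ, mul_smul] at hm; exact hM _ (ih _ hm)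
      rw [← sub_eq_zero]
      apply hn n
      rw [smul_sub, sub_eq_zero]
      exact hc
    have hs : ∀ s : Localization.Away f, ∃ (n : ℕ) (m : M), (f ^ n) • s = α0 m := by
      intro s
      obtain ⟨⟨m, ⟨_, n, rfl⟩⟩, h⟩ := IsLocalizedModule.surj (Submonoid.powers f)
        (LocalizedModule.mkLinearMap (Submonoid.powers f) M) (α.symm s)
      refine ⟨n, m, ?_⟩
      have h' : f ^ n • α.symm s = LocalizedModule.mkLinearMap (Submonoid.powers f) M m := h
      change _ = α (LocalizedModule.mkLinearMap (Submonoid.powers f) M m)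
      rw [← h']
      have := (α.toLinearMap.restrictScalars R).map_smul (f ^ n) (α.symm s)
      refine Eq.trans ?_ this.symm
      congr 1
      exact (α.apply_symm_apply s).symm
    obtain ⟨u, hu⟩ := H.exists_glue α0 hα hs β
    exact ⟨u, hu.iso_of_rel (blGlue R f u) 1 1 (by simp)⟩
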